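/- Consider a configuration model on n vertices with total degree H_n, and let Γ be a set of vertices each of degree at least y', with total degree H_{y'} := ∑_{v ∈ Γ} d_v. For a vertex w of degree at least y (with y ≤ H_n/4), the probability that none of w's half-edges pairs to a half-edge of Γ is at most (1 − H_{y'}/H_n)^{y/2}. -/

import Mathlib

open Finset Real

namespace MatchAvoid

/-- Involutions with support exactly `S`. -/
def P {H : Type*} (S : Finset H) (f : Equiv.Perm H) : Prop :=
  (∀ x, f (f x) = x) ∧ ∀ x, f x ≠ x ↔ x ∈ S

open Classical in
/-- The number of matchings of `S` avoiding `Γ` from `W`. -/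
noncomputable def A {H : Type*} [Fintype H] (Γ S W : Finset H) : ℕ :=
  (univ.filter (fun f : Equiv.Perm H => P S f ∧ ∀ w ∈ W, f w ∉ Γ)).card

/-- Number of perfect matchings on `n` points. -/
def t : ℕ → ℕ
  | 0 => 1
  | 1 => 0
  | (n + 2) => (n + 1) * t n

lemma P_down {H : Type*} [DecidableEq H] {S : Finset H} {f : Equiv.Perm H} {w v : H}
    (hf : P S f) (hwv : f w = v) :
    P ((S.erase w).erase v) (Equiv.swap w v * f) ∧
      ∀ x, x ≠ w → x ≠ v → (Equiv.swap w v * f) x = f x := by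
  obtain ⟨h1, h2⟩ := hf
  have hvw : f v = w := by rw [← hwv, h1]
  have key : ∀ x, x ≠ w → x ≠ v → (Equiv.swap w v * f) x = f x := by
    intro x hx hx'
    rw [Equiv.Perm.mul_apply]
    apply Equiv.swap_apply_of_ne_of_ne
    · intro h; apply hx'; apply f.injective; rw [h, hvw]
    · intro h; apply hx; apply f.injective; rw [h, hwv]
  have kw : (Equiv.swap w v * f) w = w := by simp [hwv]
  have kv : (Equiv.swap w v * f) v = v := by simp [hvw]
  refine ⟨⟨?_, ?_⟩, key⟩
  · intro x
    by_cases hx : x = w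
    · subst hx; rw [kw, kw]
    by_cases hx' : x = v
    · subst hx'; rw [kv, kv]
    rw [key x hx hx', key, h1]
    · intro h; apply hx'; apply f.injective; rw [h, hvw]
    · intro h; apply hx; apply f.injective; rw [h, hwv]
  · intro x
    by_cases hx : x = w
    · subst hx; rw [kw]; simp
    by_cases hx' : x = v
    · subst hx'; rw [kv]; simp
    rw [key x hx hx', h2]; simp [hx, hx']

lemma P_up {H : Type*} [DecidableEq H] {S : Finset H} {g : Equiv.Perm H} {w v : H}
    (hw : w ∈ S) (hv : v ∈ S) (hne : v ≠ w) (hg : P ((S.erase w).erase v) g) :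
    P S (Equiv.swap w v * g) ∧ (Equiv.swap w v * g) w = v := by
  obtain ⟨h1, h2⟩ := hg
  have gw : g w = w := by
    by_contra h; have := (h2 w).1 h; simp at this
  have gv : g v = v := by
    by_contra h; have := (h2 v).1 h; simp at this
  have key : ∀ x, x ≠ w → x ≠ v → (Equiv.swap w v * g) x = g x := by
    intro x hx hx'
    rw [Equiv.Perm.mul_apply]
    apply Equiv.swap_apply_of_ne_of_ne
    · intro h; apply hx; apply g.injective; rw [h, gw]
    · intro h; apply hx'; apply g.injective; rw [h, gv]
  have kw : (Equiv.swap w v * g) w = v := by simp [gw]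
  have kv : (Equiv.swap w v * g) v = w := by simp [gv]
  refine ⟨⟨?_, ?_⟩, kw⟩
  · intro x
    by_cases hx : x = w
    · subst hx; rw [kw, kv]
    by_cases hx' : x = v
    · subst hx'; rw [kv, kw]
    rw [key x hx hx', key, h1]
    · intro h; apply hx; apply g.injective; rw [h, gw]
    · intro h; apply hx'; apply g.injective; rw [h, gv]
  · intro x
    by_cases hx : x = w
    · subst hx; rw [kw]; simp [hw, hne]
    by_cases hx' : x = v
    · subst hx'; rw [kv]; simp [hv, hne.symm]
    rw [key x hx hx', h2]; simp [hx, hx']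

lemma A_le {H : Type*} [Fintype H] [DecidableEq H] (Γ S W : Finset H) (w : H)
    (hw : w ∈ S) (hwW : w ∈ W) :
    A Γ S W ≤ ∑ v ∈ S.erase w \ Γ, A Γ ((S.erase w).erase v) ((W.erase w).erase v) := by
  classical
  unfold A
  rw [card_eq_sum_card_fiberwise (f := fun f : Equiv.Perm H => f w) (t := S.erase w \ Γ)]
  · apply sum_le_sum
    intro v hv
    apply card_le_card_of_injOn (fun f => Equiv.swap w v * f)
    · intro f hf
      simp only [coe_filter, mem_filter, mem_univ, true_and, Set.mem_setOf_eq] at hf ⊢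
      obtain ⟨⟨hP, hW⟩, hwv⟩ := hf
      obtain ⟨h1, h2⟩ := P_down hP hwv
      refine ⟨h1, ?_⟩
      intro x hx
      simp only [mem_erase] at hx
      rw [h2 x hx.2.1 hx.1]
      exact hW x hx.2.2
    · intro f _ g _ h
      exact mul_left_cancel h
  · intro f hf
    simp only [coe_filter, mem_univ, true_and, Set.mem_setOf_eq] at hf
    obtain ⟨⟨h1, h2⟩, hW⟩ := hf
    have hne := (h2 w).2 hw
    simp only [coe_sdiff, coe_erase, Set.mem_diff, mem_coe, Set.mem_singleton_iff]
    refine ⟨⟨(h2 _).1 ?_, hne⟩, hW w hwW⟩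
    rw [h1]; exact hne.symm

lemma T_eq {H : Type*} [Fintype H] [DecidableEq H] (Γ S : Finset H) (w : H) (hw : w ∈ S) :
    A Γ S ∅ = ∑ v ∈ S.erase w, A Γ ((S.erase w).erase v) ∅ := by
  classical
  unfold A
  rw [card_eq_sum_card_fiberwise (f := fun f : Equiv.Perm H => f w) (t := S.erase w)]
  · apply sum_congr rfl
    intro v hv
    rw [mem_erase] at hv
    apply card_bij' (fun f _ => Equiv.swap w v * f) (fun f _ => Equiv.swap w v * f)
    · intro f hf
      simp only [mem_filter, mem_univ, true_and, notMem_empty, false_imp_iff, implies_true,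
        and_true] at hf ⊢
      exact (P_down hf.1 hf.2).1
    · intro f hf
      simp only [mem_filter, mem_univ, true_and, notMem_empty, false_imp_iff, implies_true,
        and_true] at hf ⊢
      exact P_up hw hv.2 hv.1 hf
    · intro f _; simp [← mul_assoc]
    · intro f _; simp [← mul_assoc]
  · intro f hf
    simp only [coe_filter, mem_univ, true_and, Set.mem_setOf_eq] at hf
    obtain ⟨⟨h1, h2⟩, hW⟩ := hf
    have hne := (h2 w).2 hw
    simp only [coe_erase, Set.mem_diff, mem_coe, Set.mem_singleton_iff]
    refine ⟨(h2 _).1 ?_, hne⟩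
    rw [h1]; exact hne.symm

lemma T_card {H : Type*} [Fintype H] [DecidableEq H] (Γ : Finset H) :
    ∀ (n : ℕ) (S : Finset H), S.card = n → A Γ S ∅ = t n := by
  intro n
  induction n using Nat.strong_induction_on with
  | _ n ih =>
    intro S hS
    rcases S.eq_empty_or_nonempty with rfl | ⟨w, hw⟩
    · simp only [card_empty] at hS
      subst hS
      classical
      unfold A t
      rw [card_eq_one]
      refine ⟨1, ?_⟩
      ext f
      simp only [mem_filter, mem_univ, true_and, P, notMem_empty, false_imp_iff, implies_true,
        and_true, iff_false, not_not, mem_singleton]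
      constructor
      · rintro ⟨_, h⟩; ext x; simp [h]
      · rintro rfl; simp
    · rw [T_eq Γ S w hw]
      have h1 : (S.erase w).card = n - 1 := by rw [card_erase_of_mem hw, hS]
      have hn : 0 < n := by rw [← hS]; exact card_pos.2 ⟨w, hw⟩
      have : ∀ v ∈ S.erase w, A Γ ((S.erase w).erase v) ∅ = t (n - 2) := by
        intro v hv
        apply ih _ (by omega)
        rw [card_erase_of_mem hv, h1]; omega
      rw [sum_congr rfl this, sum_const, h1, smul_eq_mul]
      match n, hn with
      | 1, _ => simp [t]
      | n + 2, _ => simp [t]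

lemma A_mono {H : Type*} [Fintype H] (Γ S W : Finset H) : A Γ S W ≤ A Γ S ∅ := by
  classical
  unfold A
  apply card_le_card
  intro f hf
  simp only [mem_filter, mem_univ, true_and, notMem_empty, false_imp_iff, implies_true,
        and_true] at hf ⊢
  exact hf.1

lemma bound {H : Type*} [Fintype H] [DecidableEq H] (Γ : Finset H) (q : ℝ) (h0 : 0 ≤ q)
    (h1 : q ≤ 1) : ∀ (m : ℕ) (S W : Finset H), Γ ⊆ S → W ⊆ S → Disjoint W Γ →
      ((S.card : ℝ) - Γ.card ≤ q * S.card) → 2 * m ≤ W.card + 1 →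
      (A Γ S W : ℝ) ≤ t S.card * q ^ m := by
  intro m
  induction m with
  | zero =>
    intro S W _ _ _ _ _
    rw [pow_zero, mul_one, ← T_card Γ _ S rfl]
    exact_mod_cast A_mono Γ S W
  | succ m ih =>
    intro S W hΓ hW hd hq hm
    obtain ⟨w, hw⟩ : W.Nonempty := by rw [← card_pos]; omega
    have hwS := hW hw
    have hwΓ : w ∉ Γ := disjoint_left.1 hd hw
    have hc1 : (S.erase w).card + 1 = S.card := card_erase_add_one hwS
    have hΓ' : Γ ⊆ S.erase w := fun x hx => mem_erase.2 ⟨fun h => hwΓ (h ▸ hx), hΓ hx⟩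
    have hterm : ∀ v ∈ S.erase w \ Γ,
        (A Γ ((S.erase w).erase v) ((W.erase w).erase v) : ℝ) ≤ t (S.card - 2) * q ^ m := by
      intro v hv
      rw [mem_sdiff] at hv
      have hc2 : ((S.erase w).erase v).card + 1 = (S.erase w).card := card_erase_add_one hv.1
      have hc : ((S.erase w).erase v).card = S.card - 2 := by omega
      rw [← hc]
      apply ih
      · exact fun x hx => mem_erase.2 ⟨fun h => hv.2 (h ▸ hx), hΓ' hx⟩
      · exact erase_subset_erase _ (erase_subset_erase _ hW)
      · exact hd.mono_left ((erase_subset _ _).trans (erase_subset _ _))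
      · have : (S.card : ℝ) = ((S.erase w).erase v).card + 2 := by
          rw [← hc1, ← hc2]; push_cast; ring
        rw [this] at hq
        linarith
      · have := pred_card_le_card_erase (s := W) (a := w)
        have := pred_card_le_card_erase (s := W.erase w) (a := v)
        omega
    have hcard : ((S.erase w \ Γ).card : ℝ) ≤ q * ((S.card : ℝ) - 1) := by
      have := card_sdiff_add_card_eq_card hΓ'
      have e : ((S.erase w \ Γ).card : ℝ) = S.card - 1 - Γ.card := by
        rw [← hc1, ← this]; push_cast; ring
      rw [e]; linarith
    have ht : ((S.card : ℝ) - 1) * t (S.card - 2) = t S.card := by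
      have : 0 < S.card := by omega
      generalize S.card = n at this
      match n, this with
      | 1, _ => simp [t]
      | n + 2, _ => simp [t]; left; ring
    calc (A Γ S W : ℝ) ≤ ∑ v ∈ S.erase w \ Γ,
          (A Γ ((S.erase w).erase v) ((W.erase w).erase v) : ℝ) := by
            exact_mod_cast A_le Γ S W w hwS hw
      _ ≤ ∑ v ∈ S.erase w \ Γ, (t (S.card - 2) * q ^ m : ℝ) := sum_le_sum hterm
      _ = (S.erase w \ Γ).card * (t (S.card - 2) * q ^ m : ℝ) := by
            rw [sum_const, nsmul_eq_mul]
      _ ≤ q * ((S.card : ℝ) - 1) * (t (S.card - 2) * q ^ m : ℝ) := by gcongr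
      _ = t S.card * q ^ (m + 1) := by rw [← ht]; ring

end MatchAvoid

/-- Configuration model as a uniform perfect matching (fixed-point-free
involution) `f` of the set `H` of half-edges, `|H| = Hₙ`. Let `Γ` be the set of half-edges
attached to the target layer (total degree `H_{y'} = |Γ|`), and `W` the half-edges of a
vertex `w` of degree `|W| ≥ y` (with `y ≤ Hₙ/4`), disjoint from `Γ`. Then the probability
that no half-edge of `w` is paired to a half-edge of `Γ` is at most
`(1 − H_{y'}/Hₙ)^{y/2}`. -/
theorem matching_avoids_layer_bound (H : Type*) [Fintype H] [DecidableEq H]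
    (heven : Even (Fintype.card H)) (hpos : 0 < Fintype.card H)
    (W Γ : Finset H) (hdisj : Disjoint W Γ)
    (y : ℕ) (hyW : y ≤ W.card) (hy4 : (y : ℝ) ≤ (Fintype.card H : ℝ) / 4) :
    (Nat.card {f : Equiv.Perm H //
        (∀ x, f x ≠ x ∧ f (f x) = x) ∧ ∀ w ∈ W, f w ∉ Γ} : ℝ) /
      (Nat.card {f : Equiv.Perm H // ∀ x, f x ≠ x ∧ f (f x) = x} : ℝ) ≤
      (1 - (Γ.card : ℝ) / (Fintype.card H : ℝ)) ^ ((y : ℝ) / 2) := by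
  classical
  have hA : Nat.card {f : Equiv.Perm H //
        (∀ x, f x ≠ x ∧ f (f x) = x) ∧ ∀ w ∈ W, f w ∉ Γ} = MatchAvoid.A Γ univ W := by
    rw [Nat.card_eq_fintype_card, Fintype.card_subtype]
    unfold MatchAvoid.A MatchAvoid.P
    congr 1
    ext f
    simp only [mem_filter, mem_univ, true_and, iff_true, forall_and]
    tauto
  have hT : Nat.card {f : Equiv.Perm H // ∀ x, f x ≠ x ∧ f (f x) = x}
      = MatchAvoid.A Γ univ ∅ := by
    rw [Nat.card_eq_fintype_card, Fintype.card_subtype]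
    unfold MatchAvoid.A MatchAvoid.P
    congr 1
    ext f
    simp only [mem_filter, mem_univ, true_and, iff_true, forall_and, notMem_empty,
      false_imp_iff, implies_true, and_true]
    tauto
  have hN : (0 : ℝ) < Fintype.card H := by exact_mod_cast hpos
  have hΓ : (Γ.card : ℝ) ≤ Fintype.card H := by exact_mod_cast card_le_univ Γ
  rw [hA, hT, MatchAvoid.T_card Γ _ univ rfl]
  set q : ℝ := 1 - (Γ.card : ℝ) / (Fintype.card H : ℝ) with hq
  have h0 : 0 ≤ q := by
    rw [hq, sub_nonneg]; exact div_le_one_of_le₀ hΓ hN.le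
  have h1 : q ≤ 1 := by
    rw [hq]; linarith [div_nonneg (Nat.cast_nonneg (α := ℝ) Γ.card) hN.le]
  have hb := MatchAvoid.bound Γ q h0 h1 ((y + 1) / 2) univ W (subset_univ _) (subset_univ _)
    hdisj (by rw [card_univ, hq, sub_mul, div_mul_cancel₀ _ hN.ne', one_mul]) (by omega)
  have hpow : q ^ ((y + 1) / 2) ≤ q ^ ((y : ℝ) / 2) := by
    rw [← Real.rpow_natCast]
    apply Real.rpow_le_rpow_of_exponent_ge' h0 h1 (by positivity)
    have : y ≤ 2 * ((y + 1) / 2) := by omega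
    have : (y : ℝ) ≤ 2 * (((y + 1) / 2 : ℕ) : ℝ) := by exact_mod_cast this
    linarith
  apply div_le_of_le_mul₀ (by positivity) (by positivity)
  calc _ ≤ _ := hb
    _ ≤ _ := by rw [mul_comm]; gcongr
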